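/- For every natural number N ≥ 2, there is no injective linear map φ from the space of real antisymmetric N×N matrices to the space of real symmetric N×N matrices such that (i) M·φ(M) = φ(M)·M for every antisymmetric M, and (ii) φ(M) = c·𝟙 for some real c implies M = 0. Consequently, energy is not observable on any N-level real quantum mechanics state space. -/

import Mathlib

open Matrix

/-- The subspace of real antisymmetric `N×N` matrices. -/
def skewMatrices (N : ℕ) : Submodule ℝ (Matrix (Fin N) (Fin N) ℝ) where
  carrier := {M | Mᵀ = -M}
  add_mem' := by
    intro a b ha hb
    simp only [Set.mem_setOf_eq] at *
    rw [Matrix.transpose_add, ha, hb, neg_add]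
  zero_mem' := by simp
  smul_mem' := by
    intro c a ha
    simp only [Set.mem_setOf_eq] at *
    rw [Matrix.transpose_smul, ha, smul_neg]

/-- The subspace of real symmetric `N×N` matrices. -/
def symmMatrices (N : ℕ) : Submodule ℝ (Matrix (Fin N) (Fin N) ℝ) where
  carrier := {M | Mᵀ = M}
  add_mem' := by
    intro a b ha hb
    simp only [Set.mem_setOf_eq] at *
    rw [Matrix.transpose_add, ha, hb]
  zero_mem' := by simp
  smul_mem' := by
    intro c a ha
    simp only [Set.mem_setOf_eq] at *
    rw [Matrix.transpose_smul, ha]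

/-- The generator of rotations in the plane of the coordinates `i` and `j`. -/
def planeRotation {N : ℕ} (i j : Fin N) : skewMatrices N :=
  ⟨single i j 1 - single j i 1, by
    change (_ : Matrix (Fin N) (Fin N) ℝ)ᵀ = -_
    simp⟩

theorem planeRotation_mul_apply {N : ℕ} (i j p q : Fin N) (S : Matrix (Fin N) (Fin N) ℝ) :
    ((planeRotation i j : Matrix (Fin N) (Fin N) ℝ) * S) p q =
      (if p = i then S j q else 0) - (if p = j then S i q else 0) := by
  simp [planeRotation, sub_mul, Matrix.mul_apply, Matrix.single_apply, ite_and, eq_comm]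

theorem mul_planeRotation_apply {N : ℕ} (i j p q : Fin N) (S : Matrix (Fin N) (Fin N) ℝ) :
    (S * (planeRotation i j : Matrix (Fin N) (Fin N) ℝ)) p q =
      (if q = j then S p i else 0) - (if q = i then S p j else 0) := by
  simp [planeRotation, mul_sub, Matrix.mul_apply, Matrix.single_apply, ite_and, eq_comm]

/-- The polarized form of the conservation law `M * φ M = φ M * M`. -/
theorem commutator_polarization {N : ℕ} {φ : skewMatrices N →ₗ[ℝ] symmMatrices N}
    (h : ∀ M : skewMatrices N, (M : Matrix (Fin N) (Fin N) ℝ) * (φ M).1 = (φ M).1 * M.1)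
    (A B : skewMatrices N) :
    A.1 * (φ B).1 + B.1 * (φ A).1 = (φ B).1 * A.1 + (φ A).1 * B.1 := by
  have hAB := h (A + B)
  simp only [map_add, Submodule.coe_add, add_mul, mul_add] at hAB
  rw [h A, h B] at hAB
  rw [← sub_eq_zero] at hAB ⊢
  rw [← hAB]
  abel

/-- A linear map that assigns to every antisymmetric matrix a symmetric matrix commuting with it
sends plane rotation generators to multiples of the identity. -/
theorem map_planeRotation_eq_smul_one {N : ℕ} {φ : skewMatrices N →ₗ[ℝ] symmMatrices N}
    (h : ∀ M : skewMatrices N, (M : Matrix (Fin N) (Fin N) ℝ) * (φ M).1 = (φ M).1 * M.1)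
    {a b : Fin N} (hab : a ≠ b) :
    (φ (planeRotation a b)).1 =
      (φ (planeRotation a b)).1 a a • (1 : Matrix (Fin N) (Fin N) ℝ) := by
  obtain ⟨S, hS⟩ : ∃ S : Fin N → Fin N → Matrix (Fin N) (Fin N) ℝ,
      ∀ i j, (φ (planeRotation i j)).1 = S i j := ⟨_, fun _ _ => rfl⟩
  have symm : ∀ i j p q, S i j p q = S i j q p := fun i j p q => by
    rw [← hS]
    exact congrFun (congrFun (φ (planeRotation i j)).2 q) p
  have comm : ∀ i j p q,
      (if p = i then S i j j q else 0) - (if p = j then S i j i q else 0) =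
        (if q = j then S i j p i else 0) - (if q = i then S i j p j else 0) := by
    intro i j p q
    simpa only [hS, planeRotation_mul_apply, mul_planeRotation_apply] using
      congrFun (congrFun (h (planeRotation i j)) p) q
  have polar : ∀ i j k p q,
      (if p = i then S i k j q else 0) - (if p = j then S i k i q else 0) +
        ((if p = i then S i j k q else 0) - (if p = k then S i j i q else 0)) =
      (if q = j then S i k p i else 0) - (if q = i then S i k p j else 0) +
        ((if q = k then S i j p i else 0) - (if q = i then S i j p k else 0)) := by
    intro i j k p q
    simpa only [hS, Matrix.add_apply, planeRotation_mul_apply, mul_planeRotation_apply] using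
      congrFun (congrFun
        (commutator_polarization h (planeRotation i j) (planeRotation i k)) p) q
  have left_off : ∀ {i j l}, i ≠ j → l ≠ i → S i j i l = 0 := by
    intro i j l hij hl
    by_cases hlj : l = j
    · subst hlj
      have := comm i l i i
      simp only [if_true, if_neg hij] at this
      linarith [symm i l i l]
    · simpa [hij.symm, hl, hlj] using comm i j j l
  have right_off : ∀ {i j l}, i ≠ j → l ≠ j → S i j j l = 0 := by
    intro i j l hij hl
    by_cases hli : l = i
    · subst hli
      rw [symm]
      exact left_off hij hij.symm
    · simpa [hij, hl, hli] using comm i j i l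
  have diag : ∀ j, S a b j j = S a b a a := by
    intro j
    by_cases hja : j = a
    · rw [hja]
    by_cases hjb : j = b
    · subst hjb
      have := comm a j a j
      simp only [if_true, if_neg hab, if_neg hja] at this
      linarith
    · have := polar a j b a j
      simp only [if_true, if_neg hab, if_neg hja, if_neg hjb, if_neg (Ne.symm hja)] at this
      linarith [right_off (i := a) (j := j) (l := b) (Ne.symm hja) (Ne.symm hjb),
        symm a j b j]
  have swap : ∀ {i j k l}, l ≠ i → l ≠ j → l ≠ k → i ≠ j → i ≠ k →
      S i j k l = -S i k j l := by
    intro i j k l hli hlj hlk hij hik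
    have := polar i j k i l
    simp only [if_true, if_neg hli, if_neg hlj, if_neg hlk, if_neg hij, if_neg hik] at this
    linarith
  rw [hS]
  ext p q
  by_cases hpq : p = q
  · subst hpq
    simp [diag]
  rw [Matrix.smul_apply, Matrix.one_apply_ne hpq, smul_zero]
  by_cases hpa : p = a
  · subst hpa
    exact left_off hab (Ne.symm hpq)
  by_cases hqa : q = a
  · subst hqa
    rw [symm]
    exact left_off hab hpq
  by_cases hpb : p = b
  · subst hpb
    exact right_off hab (Ne.symm hpq)
  by_cases hqb : q = b
  · subst hqb
    rw [symm]
    exact right_off hab hpq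
  have h₁ := swap (i := a) (j := b) (k := p) (l := q) hqa hqb (Ne.symm hpq) hab (Ne.symm hpa)
  have h₂ := swap (i := a) (j := p) (k := q) (l := b) (Ne.symm hab) (Ne.symm hpb)
    (Ne.symm hqb) (Ne.symm hpa) (Ne.symm hqa)
  have h₃ := swap (i := a) (j := q) (k := b) (l := p) hpa hpq hpb (Ne.symm hqa) hab
  linarith [symm a b p q, symm a p b q, symm a q b p]

/-- **energy is not observable in real quantum mechanics.**
For `N ≥ 2` there is no injective linear map `φ` from the real antisymmetric
`N×N` matrices (the generators of reversible time evolutions of `N`-level real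
quantum theory) to the real symmetric `N×N` matrices (the observables) such
that (i) `φ(M)` commutes with `M` for every antisymmetric `M` (conservation),
and (ii) `φ(M)` is a real multiple of the identity matrix only if `M = 0`. -/
theorem no_energy_observable_real_qm (N : ℕ) (hN : 2 ≤ N) :
    ¬ ∃ φ : skewMatrices N →ₗ[ℝ] symmMatrices N,
        Function.Injective φ ∧
        (∀ M : skewMatrices N,
          (M : Matrix (Fin N) (Fin N) ℝ) * (φ M : Matrix (Fin N) (Fin N) ℝ)
            = (φ M : Matrix (Fin N) (Fin N) ℝ) * (M : Matrix (Fin N) (Fin N) ℝ)) ∧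
        (∀ M : skewMatrices N, ∀ c : ℝ,
          (φ M : Matrix (Fin N) (Fin N) ℝ) = c • (1 : Matrix (Fin N) (Fin N) ℝ) →
          (M : Matrix (Fin N) (Fin N) ℝ) = 0) := by
  rintro ⟨φ, -, hcomm, hscalar⟩
  have hne : (⟨0, by lia⟩ : Fin N) ≠ ⟨1, by lia⟩ := by simp
  have hzero := hscalar _ _ (map_planeRotation_eq_smul_one hcomm hne)
  simpa [planeRotation, Matrix.single_apply, Fin.ext_iff] using
    congrFun (congrFun hzero ⟨0, by lia⟩) ⟨1, by lia⟩
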